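/- Let ρ > 0 and let R ∈ ℝ^{n×s}, A ∈ ℝ^{n×d}, Y ∈ ℝ^{m×s}, D ∈ ℝ^{d×m}, W ∈ ℝ^{d×m} be real matrices. Define g(B) = (1/2)‖R − A·B·Y‖_F² + tr(Dᵀ·B) + (ρ/2)‖B − W‖_F² for B ∈ ℝ^{d×m}. Then g is convex, and a matrix B* ∈ ℝ^{d×m} is a global minimizer of g if and only if B* satisfies the Sylvester-type matrix equation (1/ρ)·AᵀA·B*·(Y·Yᵀ) + B* = (1/ρ)·(Aᵀ·R·Yᵀ − D) + W. -/

import Mathlib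

open Matrix

/-- Squared Frobenius norm of a matrix: `‖M‖_F² = ∑ᵢⱼ Mᵢⱼ² = tr(MᵀM)`. -/
def frobSq {n m : ℕ} (M : Matrix (Fin n) (Fin m) ℝ) : ℝ := ∑ i, ∑ j, (M i j) ^ 2



lemma frobSq_eq_tr {n m : ℕ} (M : Matrix (Fin n) (Fin m) ℝ) : frobSq M = (Mᵀ * M).trace := by
  unfold frobSq
  simp only [Matrix.trace, Matrix.diag, Matrix.mul_apply, Matrix.transpose_apply]
  rw [Finset.sum_comm]
  simp only [sq]

lemma frobSq_nonneg' {n m : ℕ} (M : Matrix (Fin n) (Fin m) ℝ) : 0 ≤ frobSq M :=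
  Finset.sum_nonneg fun _ _ => Finset.sum_nonneg fun _ _ => sq_nonneg _

lemma frobSq_zero {n m : ℕ} (M : Matrix (Fin n) (Fin m) ℝ) (h : frobSq M = 0) : M = 0 := by
  unfold frobSq at h
  ext i j
  have h0 := (Finset.sum_eq_zero_iff_of_nonneg
    (fun i _ => Finset.sum_nonneg fun j _ => sq_nonneg (M i j))).1 h
  have h1 := h0 i (Finset.mem_univ _)
  have h2 := (Finset.sum_eq_zero_iff_of_nonneg (fun j _ => sq_nonneg (M i j))).1 h1
    j (Finset.mem_univ _)
  simpa using h2

lemma frobSq_add_smul {n m : ℕ} (M N : Matrix (Fin n) (Fin m) ℝ) (t : ℝ) :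
    frobSq (M + t • N) = frobSq M + 2 * t * (Mᵀ * N).trace + t ^ 2 * frobSq N := by
  have h : (Nᵀ * M).trace = (Mᵀ * N).trace := by
    rw [← Matrix.trace_transpose, Matrix.transpose_mul, Matrix.transpose_transpose]
  simp only [frobSq_eq_tr, Matrix.transpose_add, Matrix.transpose_smul, Matrix.add_mul,
    Matrix.mul_add, Matrix.smul_mul, Matrix.mul_smul, Matrix.trace_add, Matrix.trace_smul,
    smul_eq_mul, h]
  ring

lemma g_expand (n d m s : ℕ) (rho : ℝ)
    (R : Matrix (Fin n) (Fin s) ℝ) (A : Matrix (Fin n) (Fin d) ℝ)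
    (Y : Matrix (Fin m) (Fin s) ℝ) (D W : Matrix (Fin d) (Fin m) ℝ)
    (g : Matrix (Fin d) (Fin m) ℝ → ℝ)
    (hg : ∀ B, g B = (1 / 2) * frobSq (R - A * B * Y) + (Dᵀ * B).trace
        + (rho / 2) * frobSq (B - W)) (B H : Matrix (Fin d) (Fin m) ℝ) (t : ℝ) :
    g (B + t • H) = g B
      + t * ((D + rho • (B - W) - Aᵀ * (R - A * B * Y) * Yᵀ)ᵀ * H).trace
      + t ^ 2 * ((1 / 2) * frobSq (A * H * Y) + (rho / 2) * frobSq H) := by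
  have e1 : R - A * (B + t • H) * Y = (R - A * B * Y) + (-t) • (A * H * Y) := by
    simp only [Matrix.mul_add, Matrix.add_mul, Matrix.mul_smul, Matrix.smul_mul, neg_smul]
    abel
  have e2 : B + t • H - W = (B - W) + t • H := by abel
  have e3 : ((Aᵀ * (R - A * B * Y) * Yᵀ)ᵀ * H).trace
      = ((R - A * B * Y)ᵀ * (A * H * Y)).trace := by
    generalize R - A * B * Y = E
    rw [Matrix.transpose_mul, Matrix.transpose_mul, Matrix.transpose_transpose,
      Matrix.transpose_transpose, Matrix.mul_assoc, Matrix.trace_mul_comm]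
    simp only [Matrix.mul_assoc]
  rw [hg, hg, e1, e2, frobSq_add_smul, frobSq_add_smul,
    Matrix.transpose_sub (D + rho • (B - W)), Matrix.sub_mul (D + rho • (B - W))ᵀ,
    Matrix.trace_sub ((D + rho • (B - W))ᵀ * H), e3]
  simp only [Matrix.transpose_add, Matrix.transpose_smul, Matrix.add_mul, Matrix.mul_add,
    Matrix.smul_mul, Matrix.mul_smul, Matrix.trace_add, Matrix.trace_smul, smul_eq_mul]
  ring

/-- The `B`-update in the ADMM algorithm:
`g(B) = (1/2)‖R − A·B·Y‖_F² + tr(Dᵀ·B) + (ρ/2)‖B − W‖_F²` is convex, and `B*`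
is a global minimizer of `g` iff it satisfies the Sylvester-type equation
`(1/ρ)·AᵀA·B*·(Y·Yᵀ) + B* = (1/ρ)·(Aᵀ·R·Yᵀ − D) + W`. -/
theorem stmt9 (n d m s : ℕ) (rho : ℝ) (hrho : 0 < rho)
    (R : Matrix (Fin n) (Fin s) ℝ) (A : Matrix (Fin n) (Fin d) ℝ)
    (Y : Matrix (Fin m) (Fin s) ℝ) (D W : Matrix (Fin d) (Fin m) ℝ)
    (g : Matrix (Fin d) (Fin m) ℝ → ℝ)
    (hg : ∀ B, g B = (1 / 2) * frobSq (R - A * B * Y) + (Dᵀ * B).trace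
        + (rho / 2) * frobSq (B - W)) :
    ConvexOn ℝ Set.univ g ∧
      ∀ Bstar : Matrix (Fin d) (Fin m) ℝ,
        (∀ B, g Bstar ≤ g B) ↔
          (1 / rho) • (Aᵀ * A) * Bstar * (Y * Yᵀ) + Bstar
            = (1 / rho) • (Aᵀ * R * Yᵀ - D) + W := by
  have ex := g_expand n d m s rho R A Y D W g hg
  have hq : ∀ H : Matrix (Fin d) (Fin m) ℝ,
      0 ≤ (1 / 2) * frobSq (A * H * Y) + (rho / 2) * frobSq H := fun H => by
    have h1 := frobSq_nonneg' (A * H * Y)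
    have h2 := frobSq_nonneg' H
    positivity
  refine ⟨⟨convex_univ, ?_⟩, fun B => ?_⟩
  · intro x _ y _ a b ha hb hab
    have hx : x = (a • x + b • y) + b • (x - y) := by
      obtain rfl : a = 1 - b := by linarith
      module
    have hy : y = (a • x + b • y) + (-a) • (x - y) := by
      obtain rfl : a = 1 - b := by linarith
      module
    have h1 := ex (a • x + b • y) (x - y) b
    have h2 := ex (a • x + b • y) (x - y) (-a)
    rw [← hx] at h1
    rw [← hy] at h2
    have h3 := hq (x - y)
    rw [h1, h2, smul_eq_mul, smul_eq_mul]
    generalize g (a • x + b • y) = P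
    revert h3
    generalize (1 / 2) * frobSq (A * (x - y) * Y) + (rho / 2) * frobSq (x - y) = q
    generalize Matrix.trace ((D + rho • (a • x + b • y - W) - Aᵀ * (R - A * (a • x + b • y) * Y) * Yᵀ)ᵀ
      * (x - y)) = l
    intro h3
    have h4 : 0 ≤ (a * b ^ 2 + b * a ^ 2) * q := by positivity
    have h5 : a * P + b * P = P := by rw [← add_mul, hab, one_mul]
    nlinarith
  · have key : (1 / rho) • (Aᵀ * A) * B * (Y * Yᵀ) + B - ((1 / rho) • (Aᵀ * R * Yᵀ - D) + W)
        = (1 / rho) • (D + rho • (B - W) - Aᵀ * (R - A * B * Y) * Yᵀ) := by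
      have e : Aᵀ * (R - A * B * Y) * Yᵀ = Aᵀ * R * Yᵀ - Aᵀ * A * B * (Y * Yᵀ) := by
        simp only [Matrix.mul_sub, Matrix.sub_mul, Matrix.mul_assoc]
      have e' : (1 / rho) • (rho • (B - W)) = B - W := by
        rw [smul_smul, one_div_mul_cancel hrho.ne', one_smul]
      rw [e, smul_sub _ (D + rho • (B - W)), smul_add, e', Matrix.smul_mul, Matrix.smul_mul,
        smul_sub, smul_sub]
      abel
    rw [← sub_eq_zero (b := (1 / rho) • (Aᵀ * R * Yᵀ - D) + W), key,
      smul_eq_zero_iff_right (one_div_ne_zero hrho.ne')]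
    have exB := ex B
    revert exB
    generalize D + rho • (B - W) - Aᵀ * (R - A * B * Y) * Yᵀ = G
    intro exB
    constructor
    · intro hmin
      have h := discrim_le_zero (a := (1 / 2) * frobSq (A * G * Y) + (rho / 2) * frobSq G)
        (b := frobSq G) (c := 0) (fun t => by
          have h1 := hmin (B + t • G)
          rw [exB, ← frobSq_eq_tr] at h1
          linarith)
      apply frobSq_zero
      unfold discrim at h
      nlinarith [sq_nonneg (frobSq G)]
    · rintro rfl B'
      have h1 := exB (B' - B) 1
      have h2 := hq (B' - B)
      simp only [one_smul, add_sub_cancel, Matrix.transpose_zero, Matrix.zero_mul,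
        Matrix.trace_zero, mul_zero, one_pow, one_mul, add_zero] at h1
      linarith
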